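/- With M, X, e, f, C, A, M', C', A' and ω as in the setup, A has no submatrix of either of the following forms, where x, y, z are distinct non-zero elements of GF(4): [[x,y,x],[y,y,0],[x,0,0]]; [[x,y,x],[y,y,0],[x,0,z]]. -/

import Mathlib

open Matroid Set
open scoped Classical

namespace Relax

variable {α β : Type*}

/-- A circuit of a matroid: a minimal dependent set. -/
def Circuit (M : Matroid α) (C : Set α) : Prop :=
  M.Dep C ∧ ∀ D ⊂ C, M.Indep D

/-- A hyperplane of a matroid: a maximal proper flat. -/
def Hyperplane (M : Matroid α) (H : Set α) : Prop :=
  M.IsFlat H ∧ H ≠ M.E ∧ ∀ F, M.IsFlat F → H ⊂ F → F = M.E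

/-- `X` is a circuit-hyperplane of `M`. -/
def CircuitHyperplane (M : Matroid α) (X : Set α) : Prop :=
  Circuit M X ∧ Hyperplane M X

/-- `M'` is obtained from `M` by relaxing the circuit-hyperplane `X` : the ground set is
unchanged and the bases of `M'` are exactly the bases of `M` together with `X`. -/
def IsRelaxation (M M' : Matroid α) (X : Set α) : Prop :=
  CircuitHyperplane M X ∧ M'.E = M.E ∧ ∀ B, (M'.IsBase B ↔ M.IsBase B ∨ B = X)

/-- A matroid is representable over a field `F` if there is an assignment of vectors to its
elements under which independence coincides with linear independence. -/
def Representable (M : Matroid α) (F : Type*) [Field F] : Prop :=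
  ∃ (n : ℕ) (φ : α → (Fin n → F)), ∀ I ⊆ M.E,
    (M.Indep I ↔ LinearIndependent F (fun x : I => φ (x : α)))

/-- The field GF(4). -/
abbrev GF4 := GaloisField 2 2

/-- The rank of a set in a matroid: the maximum size of an independent subset. -/
noncomputable def rk (M : Matroid α) (X : Set α) : ℕ :=
  sSup {n | ∃ I, M.Indep I ∧ I ⊆ X ∧ I.ncard = n}

/-- Deletion of a set of elements. -/
def delete (M : Matroid α) (D : Set α) : Matroid α := M ↾ (M.E \ D)

/-- Contraction of a set of elements. -/
def contract (M : Matroid α) (C : Set α) : Matroid α := (delete M✶ C)✶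

/-- `N` is a minor of `M`. -/
def MinorOf (N M : Matroid α) : Prop :=
  ∃ C D, C ⊆ M.E ∧ D ⊆ M.E ∧ Disjoint C D ∧ N = delete (contract M C) D

/-- Isomorphism of matroids. -/
def Iso (M : Matroid α) (N : Matroid β) : Prop :=
  ∃ e : M.E ≃ N.E, ∀ I : Set M.E,
    M.Indep ((↑) '' I) ↔ N.Indep ((↑) '' (e '' I))

/-- `M` has a minor isomorphic to `N`. -/
def HasMinorIso (M : Matroid α) (N : Matroid β) : Prop :=
  ∃ M₀ : Matroid α, MinorOf M₀ M ∧ Iso M₀ N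

/-- `M` has a minor isomorphic to a member of the set `𝒩` of matroids. -/
def HasMinorIn (M : Matroid α) (𝒩 : Set (Matroid β)) : Prop :=
  ∃ N ∈ 𝒩, HasMinorIso M N

/-- `M` is `𝒩`-fragile. -/
def Fragile (M : Matroid α) (𝒩 : Set (Matroid β)) : Prop :=
  HasMinorIn M 𝒩 ∧
    ∀ a ∈ M.E, ¬ (HasMinorIn (delete M {a}) 𝒩 ∧ HasMinorIn (contract M {a}) 𝒩)

/-- `M` is (isomorphic to) the uniform matroid `U_{r,n}`. -/
def IsUniform (M : Matroid α) (r n : ℕ) : Prop :=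
  M.E.Finite ∧ M.E.ncard = n ∧ ∀ I ⊆ M.E, (M.Indep I ↔ I.ncard ≤ r)

/-- `M` has a minor isomorphic to `U_{r,n}`. -/
def HasUnifMinor (M : Matroid α) (r n : ℕ) : Prop :=
  ∃ M₀, MinorOf M₀ M ∧ IsUniform M₀ r n

/-- `M` has a `{U_{2,5}, U_{3,5}}`-minor. -/
def HasU25U35Minor (M : Matroid α) : Prop :=
  HasUnifMinor M 2 5 ∨ HasUnifMinor M 3 5

/-- `M` is `U_{2,4}`-fragile. -/
def FragileU24 (M : Matroid α) : Prop :=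
  HasUnifMinor M 2 4 ∧
    ∀ a ∈ M.E, ¬ (HasUnifMinor (delete M {a}) 2 4 ∧ HasUnifMinor (contract M {a}) 2 4)

/-- `M` is `{U_{2,5}, U_{3,5}}`-fragile. -/
def FragileU25U35 (M : Matroid α) : Prop :=
  HasU25U35Minor M ∧
    ∀ a ∈ M.E, ¬ (HasU25U35Minor (delete M {a}) ∧ HasU25U35Minor (contract M {a}))

/-- A loop. -/
def Loop (M : Matroid α) (x : α) : Prop := x ∈ M.E ∧ ¬ M.Indep {x}

/-- Two distinct non-loop elements are parallel if they form a two-element circuit. -/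
def Parallel (M : Matroid α) (x y : α) : Prop := x ≠ y ∧ Circuit M {x, y}

/-- A parallel class: a maximal set of pairwise-parallel non-loop elements. -/
def ParallelClass (M : Matroid α) (A : Set α) : Prop :=
  A ⊆ M.E ∧ (∀ x ∈ A, ¬ Loop M x) ∧
    (∀ x ∈ A, ∀ y ∈ A, x ≠ y → Parallel M x y) ∧
    (∀ B, A ⊆ B → B ⊆ M.E → (∀ x ∈ B, ¬ Loop M x) →
      (∀ x ∈ B, ∀ y ∈ B, x ≠ y → Parallel M x y) → B = A)

/-- A series class: a parallel class of the dual. -/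
def SeriesClass (M : Matroid α) (A : Set α) : Prop := ParallelClass M✶ A

/-- A matroid is connected if every two distinct elements lie in a common circuit. -/
def Connected (M : Matroid α) : Prop :=
  ∀ x ∈ M.E, ∀ y ∈ M.E, x ≠ y → ∃ C, Circuit M C ∧ x ∈ C ∧ y ∈ C

/-- A `k`-separation of `M`. -/
def Separation (M : Matroid α) (k : ℕ) (A B : Set α) : Prop :=
  A ∪ B = M.E ∧ Disjoint A B ∧ k ≤ A.ncard ∧ k ≤ B.ncard ∧
    rk M A + rk M B ≤ rk M M.E + (k - 1)

/-- A matroid is 3-connected if it is connected and has no 2-separation. -/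
def ThreeConnected (M : Matroid α) : Prop :=
  Connected M ∧ ∀ A B, ¬ Separation M 2 A B

/-- `M` is 3-connected up to series and parallel classes. -/
def ThreeConnUpToSP (M : Matroid α) : Prop :=
  Connected M ∧ ∀ A B, Separation M 2 A B →
    (SeriesClass M A ∨ ParallelClass M A ∨ SeriesClass M B ∨ ParallelClass M B)

/-- A 3-separating set of `M`. -/
def ThreeSeparating (M : Matroid α) (Y : Set α) : Prop :=
  Y ⊆ M.E ∧ rk M Y + rk M (M.E \ Y) ≤ rk M M.E + 2

/-- `M` has path width 3: there is an ordering of the ground set all of whose initial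
segments are 3-separating. -/
def PathWidth3 (M : Matroid α) : Prop :=
  ∃ (n : ℕ) (e : Fin n → α), Function.Injective e ∧ Set.range e = M.E ∧
    ∀ t : Fin n, ThreeSeparating M (e '' {i | i ≤ t})

/-- A segment: every 3-element subset is a triangle. -/
def Segment (M : Matroid α) (S : Set α) : Prop :=
  S ⊆ M.E ∧ ∀ T ⊆ S, T.ncard = 3 → Circuit M T

/-- A triangle: a 3-element circuit. -/
def Triangle (M : Matroid α) (S : Set α) : Prop := Circuit M S ∧ S.ncard = 3

/-! ### Reduced representations `[I | C]` with `C = [[A, 1], [1ᵀ, w]]` -/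

/-- The column, indexed by `x`, of the matrix `[I | C]` whose rows are indexed by
`(X \ {e}) ∪ {f}`, where `C` is the block matrix `[[A, 1], [1ᵀ, w]]` with row block `X \ {e}`,
column block `(E \ X) \ {f}`, last column `e`, last row `f`, and corner entry `w`. -/
noncomputable def colVec (X : Set α) (e f : α) (A : α → α → GF4) (w : GF4) :
    α → ((X \ {e} ∪ {f} : Set α) → GF4) := fun x r =>
  if x ∈ X \ {e} ∪ ({f} : Set α) then (if (r : α) = x then 1 else 0)
  else if (r : α) = f then (if x = e then w else 1)
  else if x = e then 1 else A (r : α) x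

/-- `M = M[I | C]` where `C` is the block matrix `[[A, 1], [1ᵀ, w]]` relative to the
basis `(X \ {e}) ∪ {f}`. -/
def RepBy (M : Matroid α) (X : Set α) (e f : α) (A : α → α → GF4) (w : GF4) : Prop :=
  ∀ I ⊆ M.E, (M.Indep I ↔
    LinearIndependent GF4 (fun x : I => colVec X e f A w (x : α)))

/-- The matrix `B`, with rows restricted to `R` and columns restricted to `K`, has an
`m × n` submatrix (up to permuting rows and columns) equal to the pattern `P`. -/
def HasPattern {m n : ℕ} (B : α → α → GF4) (R K : Set α) (P : Fin m → Fin n → GF4) : Prop :=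
  ∃ (r : Fin m → α) (c : Fin n → α), Function.Injective r ∧ Function.Injective c ∧
    (∀ i, r i ∈ R) ∧ (∀ j, c j ∈ K) ∧ ∀ i j, B (r i) (c j) = P i j

/-- One non-zero element of GF(4). -/
def NZ1 (x : GF4) : Prop := x ≠ 0

/-- Two distinct non-zero elements of GF(4). -/
def NZ2 (x y : GF4) : Prop := x ≠ 0 ∧ y ≠ 0 ∧ x ≠ y

/-- Three distinct non-zero elements of GF(4). -/
def NZ3 (x y z : GF4) : Prop :=
  x ≠ 0 ∧ y ≠ 0 ∧ z ≠ 0 ∧ x ≠ y ∧ x ≠ z ∧ y ≠ z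

/-- `B` (with rows from `R` and columns from `K`) contains one of the fifteen forbidden
submatrices, up to permuting rows and columns, where `x, y, z` denote distinct non-zero
elements of GF(4). -/
def HasForbidden (B : α → α → GF4) (R K : Set α) : Prop :=
  (∃ x y z, NZ3 x y z ∧ HasPattern B R K ![![x, y, z]]) ∨
  (∃ x y, NZ2 x y ∧ HasPattern B R K ![![x, y], ![0, x]]) ∨
  (∃ x y, NZ2 x y ∧ HasPattern B R K ![![x, y], ![y, x]]) ∨
  (∃ x y z, NZ3 x y z ∧ HasPattern B R K ![![x, y], ![z, x]]) ∨
  (∃ x y z, NZ3 x y z ∧ HasPattern B R K ![![x, x], ![y, z]]) ∨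
  (∃ x, NZ1 x ∧ HasPattern B R K ![![x, x, 0], ![x, 0, x]]) ∨
  (∃ x y, NZ2 x y ∧ HasPattern B R K ![![x, x, 0], ![x, 0, y]]) ∨
  (∃ x y, NZ2 x y ∧ HasPattern B R K ![![x, x, 0], ![y, 0, y]]) ∨
  (∃ x y, NZ2 x y ∧ HasPattern B R K ![![x, y, 0], ![x, 0, y]]) ∨
  (∃ x y z, NZ3 x y z ∧ HasPattern B R K ![![x, 0, 0], ![0, y, z]]) ∨
  (∃ x, NZ1 x ∧ HasPattern B R K ![![x, 0, 0], ![0, x, 0], ![0, 0, x]]) ∨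
  (∃ x y, NZ2 x y ∧ HasPattern B R K ![![x, 0, 0], ![0, x, 0], ![0, 0, y]]) ∨
  (∃ x y z, NZ3 x y z ∧ HasPattern B R K ![![x, 0, 0], ![0, y, 0], ![0, 0, z]]) ∨
  (∃ x y, NZ2 x y ∧ HasPattern B R K ![![x, y, x], ![y, y, 0], ![x, 0, 0]]) ∨
  (∃ x y z, NZ3 x y z ∧ HasPattern B R K ![![x, y, x], ![y, y, 0], ![x, 0, z]])

/-! ### The matroids `P₈⁻`, `F₇⁼` and its dual -/

/-- The columns of the GF(3)-matrix `[I₄ | A]` representing `P₈`, where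
`A = [[0,1,1,-1],[1,0,1,1],[1,1,0,1],[-1,1,1,0]]`. -/
def P8cols : Fin 8 → Fin 4 → ZMod 3 :=
  ![![1, 0, 0, 0], ![0, 1, 0, 0], ![0, 0, 1, 0], ![0, 0, 0, 1],
    ![0, 1, 1, -1], ![1, 0, 1, 1], ![1, 1, 0, 1], ![-1, 1, 1, 0]]

/-- `M` is isomorphic to `P₈`. -/
def IsP8 (M : Matroid α) : Prop :=
  ∃ g : α → Fin 8, Set.BijOn g M.E Set.univ ∧
    ∀ I ⊆ M.E, (M.Indep I ↔ LinearIndependent (ZMod 3) (fun x : I => P8cols (g (x : α))))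

/-- `M` is isomorphic to `P₈⁻`: it is obtained from a copy of `P₈` by relaxing one of its
pair of disjoint circuit-hyperplanes. -/
def IsP8Minus (M : Matroid α) : Prop :=
  ∃ (N : Matroid α) (X Y : Set α), IsP8 N ∧ CircuitHyperplane N Y ∧ Disjoint X Y ∧
    IsRelaxation N M X

/-- The columns of the rational matrix representing the non-Fano matroid `F₇⁻`: the seven
non-zero `{0,1}`-vectors of length 3. -/
def F7cols : Fin 7 → Fin 3 → ℚ :=
  ![![1, 0, 0], ![0, 1, 0], ![0, 0, 1], ![1, 1, 0], ![1, 0, 1], ![0, 1, 1], ![1, 1, 1]]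

/-- `M` is isomorphic to the non-Fano matroid `F₇⁻`. -/
def IsF7Minus (M : Matroid α) : Prop :=
  ∃ g : α → Fin 7, Set.BijOn g M.E Set.univ ∧
    ∀ I ⊆ M.E, (M.Indep I ↔ LinearIndependent ℚ (fun x : I => F7cols (g (x : α))))

/-- `M` is isomorphic to `F₇⁼`: it is obtained from a copy of `F₇⁻` by relaxing a
circuit-hyperplane. -/
def IsF7Eq (M : Matroid α) : Prop :=
  ∃ (N : Matroid α) (X : Set α), IsF7Minus N ∧ IsRelaxation N M X

end Relax

open Relax in
theorem linearIndependent_iff_det_ne_zero {F κ : Type*} [Field F] [Fintype κ] [DecidableEq κ]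
    {τ : Type*} (σ : κ ≃ τ) (v : κ → τ → F) :
    LinearIndependent F v ↔ (Matrix.of fun i j => v j (σ i)).det ≠ 0 := by
  have h := LinearMap.linearIndependent_iff (v := v)
    (LinearEquiv.funCongrLeft F F σ : (τ → F) →ₗ[F] (κ → F)) (LinearEquiv.ker _)
  rw [← h, ← isUnit_iff_ne_zero, ← Matrix.isUnit_iff_isUnit_det,
    ← Matrix.linearIndependent_cols_iff_isUnit]
  rfl

namespace Relax

variable {α : Type*}

/-- The entry in row `r` and column `x` of `C = [[A, 1], [1ᵀ, w]]`. -/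
noncomputable def blockEntry (e f : α) (A : α → α → GF4) (w : GF4) (r x : α) : GF4 :=
  if r = f then (if x = e then w else 1) else if x = e then 1 else A r x

theorem colVec_of_notMem {X : Set α} {e f : α} (A : α → α → GF4) (w : GF4) {x : α}
    (hx : x ∉ X \ {e} ∪ {f}) (r : (X \ {e} ∪ {f} : Set α)) :
    colVec X e f A w x r = blockEntry e f A w r x := by
  rw [colVec, if_neg hx, blockEntry]

theorem colVec_of_mem {X : Set α} {e f : α} (A : α → α → GF4) (w : GF4) {x : α}
    (hx : x ∈ X \ {e} ∪ {f}) (r : (X \ {e} ∪ {f} : Set α)) :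
    colVec X e f A w x r = if (r : α) = x then 1 else 0 := by
  rw [colVec, if_pos hx]

/-- Exchanging the basis elements `r i` for the elements `c i` keeps the columns of `[I | C]`
independent exactly when the corresponding square submatrix of `C` is nonsingular. -/
theorem linearIndependent_exchange_iff {X : Set α} {e f : α} (A : α → α → GF4) (w : GF4)
    (hfin : (X \ {e} ∪ {f}).Finite) {ι : Type*} [Fintype ι] [DecidableEq ι] {r c : ι → α}
    (hr : Function.Injective r) (hc : Function.Injective c)
    (hrB : ∀ i, r i ∈ X \ {e} ∪ {f}) (hcB : ∀ i, c i ∉ X \ {e} ∪ {f}) :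
    LinearIndependent GF4
      (fun x : ((X \ {e} ∪ {f}) \ range r ∪ range c : Set α) => colVec X e f A w (x : α)) ↔
      (Matrix.of fun i j => blockEntry e f A w (r i) (c j)).det ≠ 0 := by
  set B : Set α := X \ {e} ∪ {f} with hB
  have hfin' : (B \ range r).Finite := hfin.subset sdiff_subset
  have : Fintype (B \ range r : Set α) := hfin'.fintype
  have hdisj : Disjoint (B \ range r) (range c) := by
    rw [Set.disjoint_right]
    rintro _ ⟨i, rfl⟩ h
    exact hcB i h.1
  let σ : ((B \ range r : Set α) ⊕ ι) ≃ B :=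
    ((Equiv.refl _).sumCongr (Equiv.ofInjective r hr)).trans
      ((Equiv.Set.union disjoint_sdiff_left).symm.trans
        (Equiv.setCongr (sdiff_union_of_subset (range_subset_iff.2 hrB))))
  let τ : ((B \ range r : Set α) ⊕ ι) ≃ (B \ range r ∪ range c : Set α) :=
    ((Equiv.refl _).sumCongr (Equiv.ofInjective c hc)).trans (Equiv.Set.union hdisj).symm
  have hσl : ∀ b, (σ (Sum.inl b) : α) = b := fun b => by simp [σ]
  have hσr : ∀ i, (σ (Sum.inr i) : α) = r i := fun i => by simp [σ]
  have hτl : ∀ b, (τ (Sum.inl b) : α) = b := fun b => by simp [τ]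
  have hτr : ∀ i, (τ (Sum.inr i) : α) = c i := fun i => by simp [τ]
  rw [← linearIndependent_equiv τ, linearIndependent_iff_det_ne_zero σ]
  have hblock : (Matrix.of fun i j =>
      ((fun x : (B \ range r ∪ range c : Set α) => colVec X e f A w (x : α)) ∘ τ) j (σ i)) =
      Matrix.fromBlocks 1 (Matrix.of fun (b : (B \ range r : Set α)) j =>
        blockEntry e f A w b (c j)) 0
        (Matrix.of fun i j => blockEntry e f A w (r i) (c j)) := by
    ext i j
    rcases j with b | j
    · simp only [Matrix.of_apply, Function.comp, hτl]
      rw [colVec_of_mem A w b.2.1]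
      rcases i with b' | i
      · simp [hσl, Matrix.one_apply, Subtype.ext_iff]
      · have : r i ≠ b := fun h => b.2.2 ⟨i, h⟩
        simp [hσr, this]
    · simp only [Matrix.of_apply, Function.comp, hτr]
      rw [colVec_of_notMem A w (hcB j)]
      rcases i with b' | i
      · simp [hσl]
      · simp [hσr]
  rw [hblock, Matrix.det_fromBlocks_zero₂₁, Matrix.det_one, one_mul]

theorem IsRelaxation.indep_iff {M M' : Matroid α} {X I : Set α} (h : IsRelaxation M M' X)
    (hI : ¬ I ⊆ X) : M'.Indep I ↔ M.Indep I := by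
  rw [Matroid.indep_iff, Matroid.indep_iff]
  constructor
  · rintro ⟨B, hB, hIB⟩
    rcases (h.2.2 B).1 hB with hB | rfl
    · exact ⟨B, hB, hIB⟩
    · exact absurd hIB hI
  · rintro ⟨B, hB, hIB⟩
    exact ⟨B, (h.2.2 B).2 (Or.inl hB), hIB⟩

/-- Corresponding square submatrices of `C` and `C'` that use a column outside `X` are
both singular or both nonsingular. -/
theorem IsRelaxation.det_eq_zero_iff {M M' : Matroid α} {X : Set α} {e f : α}
    {A A' : α → α → GF4} {w w' : GF4} (hfin : M.E.Finite) (hrel : IsRelaxation M M' X)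
    (hBE : X \ {e} ∪ {f} ⊆ M.E) (hA : RepBy M X e f A w) (hA' : RepBy M' X e f A' w')
    {ι : Type*} [Fintype ι] [DecidableEq ι] {r c : ι → α}
    (hr : Function.Injective r) (hc : Function.Injective c)
    (hrB : ∀ i, r i ∈ X \ {e} ∪ {f}) (hcE : ∀ i, c i ∈ M.E \ (X \ {e} ∪ {f}))
    (hX : ∃ i, c i ∉ X) :
    (Matrix.of fun i j => blockEntry e f A w (r i) (c j)).det = 0 ↔
      (Matrix.of fun i j => blockEntry e f A' w' (r i) (c j)).det = 0 := by
  have hIE : (X \ {e} ∪ {f}) \ range r ∪ range c ⊆ M.E :=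
    union_subset (sdiff_subset.trans hBE) (range_subset_iff.2 fun i => (hcE i).1)
  have hIX : ¬ (X \ {e} ∪ {f}) \ range r ∪ range c ⊆ X := by
    obtain ⟨i, hi⟩ := hX
    exact fun h => hi (h (Or.inr ⟨i, rfl⟩))
  have key := hrel.indep_iff hIX
  rw [hA _ hIE, hA' _ (hrel.2.1 ▸ hIE),
    linearIndependent_exchange_iff A w (hfin.subset hBE) hr hc hrB fun i => (hcE i).2,
    linearIndependent_exchange_iff A' w' (hfin.subset hBE) hr hc hrB fun i => (hcE i).2] at key
  exact not_iff_not.1 key.symm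

theorem GF4.two_eq_zero : (2 : GF4) = 0 := by
  have := CharP.cast_eq_zero GF4 2
  simpa using this

theorem GF4.pow_three {a : GF4} (ha : a ≠ 0) : a ^ 3 = 1 := by
  have : Fintype GF4 := Fintype.ofFinite _
  have hcard : Fintype.card GF4 = 4 := by
    rw [← Nat.card_eq_fintype_card, GaloisField.card 2 2 (by norm_num)]
    norm_num
  have := FiniteField.pow_card_sub_one_eq_one a ha
  rwa [hcard] at this

theorem GF4.sq_add_mul_add_sq {a b : GF4} (ha : a ≠ 0) (hb : b ≠ 0) (hab : a ≠ b) :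
    a ^ 2 + a * b + b ^ 2 = 0 := by
  refine (mul_eq_zero.1 ?_).resolve_left (sub_ne_zero.2 hab)
  linear_combination GF4.pow_three ha - GF4.pow_three hb

theorem GF4.eq_add {a b c : GF4} (h : NZ3 a b c) : c = a + b := by
  obtain ⟨ha, hb, hc, hab, hac, hbc⟩ := h
  have h1 := GF4.sq_add_mul_add_sq ha hb hab
  have h2 := GF4.sq_add_mul_add_sq ha hc hac
  have h3 : (b - c) * (a + b + c) = 0 := by linear_combination h1 - h2
  have h4 := (mul_eq_zero.1 h3).resolve_left (sub_ne_zero.2 hbc)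
  linear_combination h4 - (a + b) * GF4.two_eq_zero

theorem GF4.eq_one_or_eq {a w : GF4} (ha : a ≠ 0) (hw0 : w ≠ 0) (hw1 : w ≠ 1)
    (haw : a * w ≠ 1) : a = 1 ∨ a = w := by
  by_contra! h
  have h1 := GF4.eq_add ⟨one_ne_zero, hw0, ha, hw1.symm, h.1.symm, h.2.symm⟩
  have h2 := GF4.sq_add_mul_add_sq hw0 one_ne_zero hw1
  apply haw
  rw [h1]
  linear_combination h2 - GF4.two_eq_zero

/-- The consequences for a pair of matrices `A` and `A'` of the matroid and its relaxation
agreeing on all sets not contained in `X`. -/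
structure RelaxedPair (R K : Set α) (A A' : α → α → GF4) (w : GF4) : Prop where
  zero_iff : ∀ r ∈ R, ∀ c ∈ K, (A r c = 0 ↔ A' r c = 0)
  row_iff : ∀ r ∈ R, ∀ c ∈ K, ∀ d ∈ K, (A r c = A r d ↔ A' r c = A' r d)
  col_iff : ∀ r ∈ R, ∀ s ∈ R, ∀ c ∈ K, (A r c = A s c ↔ A' r c = A' s c)
  mul_ne_one : ∀ r ∈ R, ∀ c ∈ K, A' r c * w ≠ 1
  det_iff : ∀ r : Fin 3 → α, ∀ c : Fin 3 → α, Function.Injective r → Function.Injective c →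
    (∀ i, r i ∈ R) → (∀ i, c i ∈ K) →
      ((Matrix.of fun i j => A (r i) (c j)).det = 0 ↔
        (Matrix.of fun i j => A' (r i) (c j)).det = 0)
  bordered_det_iff : ∀ r : Fin 3 → α, ∀ c : Fin 3 → α, Function.Injective r →
    Function.Injective c → (∀ i, r i ∈ R) → (∀ i, c i ∈ K) →
      ((Matrix.fromBlocks (Matrix.of fun i j => A (r i) (c j)) (Matrix.of fun _ _ => 1)
        (Matrix.of fun _ _ => 1) (Matrix.of fun (_ _ : Fin 1) => 0)).det = 0 ↔
      (Matrix.fromBlocks (Matrix.of fun i j => A' (r i) (c j)) (Matrix.of fun _ _ => 1)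
        (Matrix.of fun _ _ => 1) (Matrix.of fun (_ _ : Fin 1) => w)).det = 0)

theorem IsRelaxation.relaxedPair {M M' : Matroid α} {X : Set α} {e f : α}
    {A A' : α → α → GF4} {w : GF4} (hfin : M.E.Finite) (hrel : IsRelaxation M M' X)
    (he : e ∈ X) (hf : f ∈ M.E \ X) (hBE : X \ {e} ∪ {f} ⊆ M.E)
    (hA : RepBy M X e f A 0) (hA' : RepBy M' X e f A' w) :
    RelaxedPair (X \ {e}) ((M.E \ X) \ {f}) A A' w := by
  have heE : e ∈ M.E := hrel.1.1.1.subset_ground he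
  have hef : e ≠ f := fun h => hf.2 (h ▸ he)
  have key {ι : Type} [Fintype ι] [DecidableEq ι] {r c : ι → α}
      (hr : Function.Injective r) (hc : Function.Injective c)
      (hrB : ∀ i, r i ∈ X \ {e} ∪ {f}) (hcE : ∀ i, c i ∈ M.E \ (X \ {e} ∪ {f}))
      (hX : ∃ i, c i ∉ X) := hrel.det_eq_zero_iff hfin hBE hA hA' hr hc hrB hcE hX
  have hrf : ∀ r ∈ X \ {e}, r ≠ f := fun r hr h => hf.2 (h ▸ hr.1)
  have hce : ∀ c ∈ (M.E \ X) \ {f}, c ≠ e := fun c hc h => hc.1.2 (h ▸ he)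
  have hR : ∀ r ∈ X \ {e}, r ∈ X \ {e} ∪ {f} := fun r hr => Or.inl hr
  have hfB : f ∈ X \ {e} ∪ {f} := Or.inr rfl
  have hK : ∀ c ∈ (M.E \ X) \ {f}, c ∈ M.E \ (X \ {e} ∪ {f}) := fun c hc =>
    ⟨hc.1.1, fun h => h.elim (fun h => hc.1.2 h.1) hc.2⟩
  have heK : e ∈ M.E \ (X \ {e} ∪ {f}) := ⟨heE, fun h => h.elim (fun h => h.2 rfl) hef⟩
  have pair {a b : α} (hab : a ≠ b) : Function.Injective ![a, b] := by
    intro i j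
    fin_cases i <;> fin_cases j <;> simp [hab, hab.symm]
  refine ⟨?_, ?_, ?_, ?_, ?_, ?_⟩
  · intro r hr c hc
    have := key (ι := Unit) (r := fun _ => r) (c := fun _ => c)
      (Function.injective_of_subsingleton _) (Function.injective_of_subsingleton _)
      (fun _ => hR r hr) (fun _ => hK c hc) ⟨(), hc.1.2⟩
    simpa [blockEntry, hrf r hr, hce c hc] using this
  · intro r hr c hc d hd
    by_cases hcd : c = d
    · simp [hcd]
    have := key (pair (hrf r hr)) (pair hcd) (by rw [Fin.forall_fin_two]; exact ⟨hR r hr, hfB⟩)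
      (by rw [Fin.forall_fin_two]; exact ⟨hK c hc, hK d hd⟩) ⟨0, hc.1.2⟩
    simpa [Matrix.det_fin_two, blockEntry, hrf r hr, hce c hc, hce d hd, sub_eq_zero] using this
  · intro r hr s hs c hc
    by_cases hrs : r = s
    · simp [hrs]
    have := key (pair hrs) (pair (hce c hc))
      (by rw [Fin.forall_fin_two]; exact ⟨hR r hr, hR s hs⟩)
      (by rw [Fin.forall_fin_two]; exact ⟨hK c hc, heK⟩) ⟨0, hc.1.2⟩
    simpa [Matrix.det_fin_two, blockEntry, hrf r hr, hrf s hs, hce c hc, sub_eq_zero] using this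
  · intro r hr c hc
    have := key (pair (hrf r hr)) (pair (hce c hc)) (by rw [Fin.forall_fin_two]; exact ⟨hR r hr, hfB⟩)
      (by rw [Fin.forall_fin_two]; exact ⟨hK c hc, heK⟩) ⟨0, hc.1.2⟩
    simpa [Matrix.det_fin_two, blockEntry, hrf r hr, hce c hc, sub_eq_zero] using this
  · intro r c hri hci hr hc
    have := key hri hci (fun i => hR _ (hr i)) (fun i => hK _ (hc i)) ⟨0, (hc 0).1.2⟩
    simpa [blockEntry, fun i => hrf _ (hr i), fun i => hce _ (hc i)] using this
  · intro r c hri hci hr hc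
    have := key (ι := Fin 3 ⊕ Fin 1) (r := Sum.elim r fun _ => f) (c := Sum.elim c fun _ => e)
      (hri.sumElim (Function.injective_of_subsingleton _) fun i _ => hrf _ (hr i))
      (hci.sumElim (Function.injective_of_subsingleton _) fun i _ => hce _ (hc i))
      (by rintro (i | _); exacts [hR _ (hr i), hfB])
      (by rintro (i | _); exacts [hK _ (hc i), heK]) ⟨Sum.inl 0, (hc 0).1.2⟩
    convert this using 3 <;>
    · ext (i | i) (j | j) <;>
        simp [blockEntry, fun i => hrf _ (hr i), fun i => hce _ (hc i)]

/-- The determinant of a `3 × 3` matrix bordered by ones. -/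
theorem det_bordered {F : Type*} [CommRing F] (P : Matrix (Fin 3) (Fin 3) F) (w : F) :
    (Matrix.fromBlocks P (Matrix.of fun _ _ => 1)
        (Matrix.of fun _ _ => 1) (Matrix.of fun (_ _ : Fin 1) => w)).det =
      w * P.det - ∑ i, ∑ j, P.adjugate i j := by
  have h : Matrix.fromBlocks P (Matrix.of fun _ _ => 1)
      (Matrix.of fun _ _ => 1) (Matrix.of fun (_ _ : Fin 1) => w) =
      (!![P 0 0, P 0 1, P 0 2, 1; P 1 0, P 1 1, P 1 2, 1; P 2 0, P 2 1, P 2 2, 1;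
        1, 1, 1, w]).submatrix (finSumFinEquiv (m := 3) (n := 1)) finSumFinEquiv := by
    ext (i | i) (j | j) <;> fin_cases i <;> fin_cases j <;> rfl
  rw [h, Matrix.det_submatrix_equiv_self, Matrix.adjugate_fin_three]
  simp [Matrix.det_succ_row_zero, Fin.sum_univ_succ, Fin.succAbove]
  ring

theorem RelaxedPair.pattern {R K : Set α} {A A' : α → α → GF4} {w : GF4}
    (h : RelaxedPair R K A A' w) (hw0 : w ≠ 0) (hw1 : w ≠ 1) {x y t : GF4} (hxy : NZ2 x y)
    {r c : Fin 3 → α} (hr : ∀ i, r i ∈ R) (hc : ∀ j, c j ∈ K)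
    (hP : ∀ i j, A (r i) (c j) = ![![x, y, x], ![y, y, 0], ![x, 0, t]] i j) :
    ∃ p q t' : GF4, NZ2 p q ∧ (t = 0 → t' = 0) ∧ (NZ3 x y t → t' = q) ∧
      ∀ i j, A' (r i) (c j) = ![![p, q, p], ![q, q, 0], ![p, 0, t']] i j := by
  obtain ⟨hx, hy, hxy⟩ := hxy
  have zero (i j) := h.zero_iff _ (hr i) _ (hc j)
  have row (i j k) := h.row_iff _ (hr i) _ (hc j) _ (hc k)
  have col (i j k) := h.col_iff _ (hr i) _ (hr j) _ (hc k)
  have mul (i j) := h.mul_ne_one _ (hr i) _ (hc j)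
  simp only [hP] at zero row col
  have h02 : A' (r 0) (c 0) = A' (r 0) (c 2) := (row 0 0 2).1 (by simp)
  have h20 : A' (r 0) (c 0) = A' (r 2) (c 0) := (col 0 2 0).1 (by simp)
  have h11 : A' (r 0) (c 1) = A' (r 1) (c 1) := (col 0 1 1).1 (by simp)
  have h10 : A' (r 1) (c 0) = A' (r 1) (c 1) := (row 1 0 1).1 (by simp)
  have h12 : A' (r 1) (c 2) = 0 := (zero 1 2).1 (by simp)
  have h21 : A' (r 2) (c 1) = 0 := (zero 2 1).1 (by simp)
  have hp : A' (r 0) (c 0) ≠ 0 := fun h => hx (by simpa using (zero 0 0).2 h)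
  have hq : A' (r 0) (c 1) ≠ 0 := fun h => hy (by simpa using (zero 0 1).2 h)
  have hpq : A' (r 0) (c 0) ≠ A' (r 0) (c 1) := fun h => hxy (by simpa using (row 0 0 1).2 h)
  refine ⟨A' (r 0) (c 0), A' (r 0) (c 1), A' (r 2) (c 2), ⟨hp, hq, hpq⟩, ?_, ?_, ?_⟩
  · intro ht
    exact (zero 2 2).1 (by simpa using ht)
  · rintro ⟨-, -, ht, -, hxt, -⟩
    have ht0 : A' (r 2) (c 2) ≠ 0 := fun h => ht (by simpa using (zero 2 2).2 h)
    have htp : A' (r 0) (c 0) ≠ A' (r 2) (c 2) := fun h =>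
      hxt (by simpa using (row 2 0 2).2 (h20 ▸ h))
    have hp' := GF4.eq_one_or_eq hp hw0 hw1 (mul 0 0)
    have hq' := GF4.eq_one_or_eq hq hw0 hw1 (mul 0 1)
    have ht' := GF4.eq_one_or_eq ht0 hw0 hw1 (mul 2 2)
    grind
  · intro i j
    fin_cases i <;> fin_cases j <;> simp [h02, h11, h10, h12, h21]
    grind

end Relax

/-- With the setup as given, `A` has no submatrix of either of the forms
`[[x,y,x],[y,y,0],[x,0,0]]` or `[[x,y,x],[y,y,0],[x,0,z]]`, where `x, y, z` are distinct
non-zero elements of GF(4). -/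
theorem statement18 {α : Type*} (M M' : Matroid α) (X : Set α) (e f : α)
    (A A' : α → α → Relax.GF4) (w : Relax.GF4)
    (hfin : M.E.Finite)
    (hrel : Relax.IsRelaxation M M' X)
    (he : e ∈ X) (hf : f ∈ M.E \ X)
    (hB : M.IsBase (X \ {e} ∪ {f}))
    (hA : Relax.RepBy M X e f A 0)
    (hw0 : w ≠ 0) (hw1 : w ≠ 1)
    (hA' : Relax.RepBy M' X e f A' w) :
    (¬ ∃ x y, Relax.NZ2 x y ∧
      Relax.HasPattern A (X \ {e}) ((M.E \ X) \ {f})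
        ![![x, y, x], ![y, y, 0], ![x, 0, 0]]) ∧
    (¬ ∃ x y z, Relax.NZ3 x y z ∧
      Relax.HasPattern A (X \ {e}) ((M.E \ X) \ {f})
        ![![x, y, x], ![y, y, 0], ![x, 0, z]]) := by
  have hp := hrel.relaxedPair hfin he hf hB.subset_ground hA hA'
  constructor
  · rintro ⟨x, y, hxy, r, c, hri, hci, hr, hc, hP⟩
    obtain ⟨p, q, t, hpq, ht, -, hP'⟩ := hp.pattern hw0 hw1 hxy hr hc hP
    have hdet := hp.bordered_det_iff r c hri hci hr hc
    simp only [hP, hP', ht rfl, Relax.det_bordered, Matrix.adjugate_fin_three,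
      Matrix.det_fin_three, Fin.sum_univ_three] at hdet
    simp at hdet
    have h1 := Relax.GF4.sq_add_mul_add_sq hxy.1 hxy.2.1 hxy.2.2
    have h2 := Relax.GF4.sq_add_mul_add_sq hpq.1 hpq.2.1 hpq.2.2
    have two := Relax.GF4.two_eq_zero
    obtain ⟨hp0, hq0, -⟩ := hpq
    have h3 := hdet.1 (by linear_combination h1 - x * y * two)
    have h4 : w * (p * q * p) = 0 := by linear_combination h2 - h3 - p * q * two
    exact mul_ne_zero hw0 (mul_ne_zero (mul_ne_zero hp0 hq0) hp0) h4
  · rintro ⟨x, y, z, hxyz, r, c, hri, hci, hr, hc, hP⟩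
    obtain ⟨hx, hy, hz, hxy, hxz, hyz⟩ := id hxyz
    obtain ⟨p, q, t, hpq, -, ht, hP'⟩ := hp.pattern hw0 hw1 ⟨hx, hy, hxy⟩ hr hc hP
    have hdet := hp.det_iff r c hri hci hr hc
    simp only [hP, hP', ht hxyz, Matrix.det_fin_three] at hdet
    simp at hdet
    have h2 := Relax.GF4.sq_add_mul_add_sq hpq.1 hpq.2.1 hpq.2.2
    have hz := Relax.GF4.eq_add hxyz
    have two := Relax.GF4.two_eq_zero
    have h3 := hdet.2 (by linear_combination -q * h2 + p * q * q * two)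
    rw [hz] at h3
    exact pow_ne_zero 3 hy (by linear_combination -h3)
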